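/- Let ξ₁, η₁, ξ₂, η₂ ∈ C_c²((0,∞)) and let f = ξ₁ *_{s} η₁ and g = ξ₂ *_{s'} η₂, where each of s, s' is one of the two signs + or −. Then ∫₀^∞ ∫_ℝ (−(2πi)⁻¹ a (∂/∂b) f(b,a)) · g(b,a) db a⁻² da = − ∫₀^∞ ∫_ℝ f(b,a) · (−(2πi)⁻¹ a (∂/∂b) g(b,a)) db a⁻² da (both integrands being integrable). In other words, the bilinear form D♭(f,g) = ∫_G (−(2πi)⁻¹ a ∂_b f) g dμ is antisymmetric on coefficient functions. -/

import Mathlib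

open MeasureTheory Set

/-- Coefficient function of the representation `π₊` of the real `ax+b` group:
`(ξ *₊ η)(b,a) = ∫₀^∞ e^{-2πibt} ξ(at) conj(η(t)) t⁻¹ dt`. -/
noncomputable def coeffP (ξ η : ℝ → ℂ) (b a : ℝ) : ℂ :=
  ∫ t in Ioi (0 : ℝ),
    Complex.exp (-(2 * Real.pi * b * t : ℝ) * Complex.I) * ξ (a * t)
      * starRingEnd ℂ (η t) * (t : ℂ)⁻¹

/-- Coefficient function of the representation `π₋` of the real `ax+b` group:
`(ξ *₋ η)(b,a) = ∫₀^∞ e^{2πibt} ξ(at) conj(η(t)) t⁻¹ dt`. -/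
noncomputable def coeffM (ξ η : ℝ → ℂ) (b a : ℝ) : ℂ :=
  ∫ t in Ioi (0 : ℝ),
    Complex.exp ((2 * Real.pi * b * t : ℝ) * Complex.I) * ξ (a * t)
      * starRingEnd ℂ (η t) * (t : ℂ)⁻¹

/-- `C_c²((0,∞))`: twice continuously differentiable complex-valued functions on `ℝ`
with compact support contained in `(0,∞)`. -/
def CcTwo (f : ℝ → ℂ) : Prop :=
  ContDiff ℝ 2 f ∧ HasCompactSupport f ∧ tsupport f ⊆ Ioi (0 : ℝ)

/-- Left Haar measure `a⁻² db da` of the `ax+b` group, modelled on `ℝ × (0,∞)`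
(first coordinate `b`, second coordinate `a`). -/
noncomputable def muG : Measure (ℝ × ℝ) :=
  (((volume : Measure ℝ).prod ((volume : Measure ℝ).restrict (Ioi (0 : ℝ)))).withDensity
    fun p => ENNReal.ofReal ((p.2 ^ 2)⁻¹))

/-- Coefficient function with a sign: `coeffS true = coeffP` (the `π₊` case) and
`coeffS false = coeffM` (the `π₋` case). -/
noncomputable def coeffS (s : Bool) (ξ η : ℝ → ℂ) (b a : ℝ) : ℂ :=
  if s then coeffP ξ η b a else coeffM ξ η b a

open FourierTransform

/-- Continuously differentiable functions on `ℝ` with compact support contained in `(0,∞)`. -/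
def CcOne (f : ℝ → ℂ) : Prop :=
  ContDiff ℝ 1 f ∧ HasCompactSupport f ∧ tsupport f ⊆ Ioi (0 : ℝ)

/-- The Fourier transform at `b` of the function `t ↦ ξ (a t) h t`. -/
noncomputable def dilationFourier (ξ h : ℝ → ℂ) (b a : ℝ) : ℂ :=
  𝓕 (fun t : ℝ => ξ (a * t) * h t) b

/-- The sign `ε` such that `coeffS s ξ η b` is a Fourier transform evaluated at `ε b`. -/
def fourierSign (s : Bool) : ℝ := if s then 1 else -1

lemma abs_fourierSign (s : Bool) : |fourierSign s| = 1 := by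
  cases s <;> simp [fourierSign]

lemma CcTwo.ccOne {f : ℝ → ℂ} (hf : CcTwo f) : CcOne f :=
  ⟨hf.1.of_le (by norm_num), hf.2⟩

lemma CcOne.mul_of_contDiffAt {f g : ℝ → ℂ} (hf : CcOne f)
    (hg : ∀ x, 0 < x → ContDiffAt ℝ 1 g x) : CcOne (fun t => f t * g t) := by
  have hsub : tsupport (fun t => f t * g t) ⊆ tsupport f := tsupport_mul_subset_left
  refine ⟨contDiff_iff_contDiffAt.2 fun x => ?_, hf.2.1.mul_right, hsub.trans hf.2.2⟩
  by_cases hx : x ∈ tsupport fun t => f t * g t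
  · exact hf.1.contDiffAt.mul (hg x (hf.2.2 (hsub hx)))
  · exact contDiffAt_const.congr_of_eventuallyEq (notMem_tsupport_iff_eventuallyEq.1 hx)

lemma CcTwo.conj_mul_inv {η : ℝ → ℂ} (hη : CcTwo η) :
    CcOne (fun t => starRingEnd ℂ (η t) * (t : ℂ)⁻¹) := by
  have hconj : CcOne (fun t => starRingEnd ℂ (η t)) := by
    have hsub : tsupport (fun t => starRingEnd ℂ (η t)) ⊆ tsupport η :=
      closure_mono fun x hx => by simpa using hx
    exact ⟨Complex.conjCLE.contDiff.comp hη.ccOne.1, hη.2.1.comp_left (map_zero _),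
      hsub.trans hη.2.2⟩
  refine hconj.mul_of_contDiffAt fun x hx => ?_
  exact Complex.ofRealCLM.contDiff.contDiffAt.inv (by simpa using hx.ne')

lemma CcOne.mul_ofReal {h : ℝ → ℂ} (hh : CcOne h) : CcOne (fun t => h t * (t : ℂ)) :=
  hh.mul_of_contDiffAt fun _ _ => Complex.ofRealCLM.contDiff.contDiffAt

lemma CcOne.eq_zero_of_nonpos {f : ℝ → ℂ} (hf : CcOne f) {t : ℝ} (ht : t ≤ 0) : f t = 0 :=
  image_eq_zero_of_notMem_tsupport fun h => not_lt.2 ht (hf.2.2 h)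

lemma CcOne.exists_support_subset_Icc {f : ℝ → ℂ} (hf : CcOne f) :
    ∃ m M : ℝ, 0 < m ∧ 0 < M ∧ ∀ t, f t ≠ 0 → t ∈ Icc m M := by
  rcases (tsupport f).eq_empty_or_nonempty with he | hne
  · refine ⟨1, 1, one_pos, one_pos, fun t ht => ?_⟩
    have := subset_tsupport f ht
    simp [he] at this
  · have hc : IsCompact (tsupport f) := hf.2.1
    obtain ⟨m, hm⟩ := hc.exists_isLeast hne
    obtain ⟨M, hM⟩ := hc.exists_isGreatest hne
    refine ⟨m, M, hf.2.2 hm.1, hf.2.2 hM.1, fun t ht => ?_⟩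
    exact ⟨hm.2 (subset_tsupport f ht), hM.2 (subset_tsupport f ht)⟩

lemma coeffS_eq_dilationFourier (s : Bool) (ξ : ℝ → ℂ) {η : ℝ → ℂ} (hη : CcTwo η) (b a : ℝ) :
    coeffS s ξ η b a
      = dilationFourier ξ (fun t => starRingEnd ℂ (η t) * (t : ℂ)⁻¹) (fourierSign s * b) a := by
  have hzero : ∀ t : ℝ, t ∉ Ioi (0 : ℝ) → η t = 0 := fun t ht =>
    hη.ccOne.eq_zero_of_nonpos (not_lt.1 ht)
  rw [dilationFourier, Real.fourier_real_eq_integral_exp_smul]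
  cases s
  · simp only [coeffS, coeffM, fourierSign, Bool.false_eq_true, if_false]
    rw [setIntegral_eq_integral_of_forall_compl_eq_zero fun t ht => by simp [hzero t ht]]
    refine integral_congr_ae (Filter.Eventually.of_forall fun t => ?_)
    simp only [smul_eq_mul]
    rw [show -2 * Real.pi * t * (-1 * b) = 2 * Real.pi * b * t by ring]
    ring
  · simp only [coeffS, coeffP, fourierSign, if_true]
    rw [setIntegral_eq_integral_of_forall_compl_eq_zero fun t ht => by simp [hzero t ht]]
    refine integral_congr_ae (Filter.Eventually.of_forall fun t => ?_)
    simp only [smul_eq_mul]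
    rw [show -2 * Real.pi * t * (1 * b) = -(2 * Real.pi * b * t) by ring]
    push_cast
    ring

lemma integrable_comp_mul_mul {ξ h : ℝ → ℂ} (hξ : Continuous ξ) (hh : Continuous h)
    (hhc : HasCompactSupport h) (a : ℝ) : Integrable (fun t : ℝ => ξ (a * t) * h t) :=
  Continuous.integrable_of_hasCompactSupport (by fun_prop) hhc.mul_left

lemma exists_norm_dilationFourier_le {ξ h : ℝ → ℂ} (hξ : Continuous ξ)
    (hξc : HasCompactSupport ξ) (hh : Continuous h) (hhc : HasCompactSupport h) :
    ∃ C, 0 ≤ C ∧ ∀ b a, ‖dilationFourier ξ h b a‖ ≤ C := by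
  obtain ⟨K, hK⟩ := hξc.exists_bound_of_continuous hξ
  have hK0 : 0 ≤ K := (norm_nonneg _).trans (hK 0)
  refine ⟨∫ t, K * ‖h t‖, integral_nonneg fun t => by positivity, fun b a => ?_⟩
  rw [dilationFourier, Real.fourier_real_eq]
  refine norm_integral_le_of_norm_le
    ((hh.integrable_of_hasCompactSupport hhc).norm.const_mul K) ?_
  refine Filter.Eventually.of_forall fun t => ?_
  rw [Circle.norm_smul, norm_mul]
  gcongr
  exact hK _

lemma mul_dilationFourier {ξ h : ℝ → ℂ} (hξ : CcOne ξ) (hh : CcOne h) (b a : ℝ) :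
    2 * Real.pi * Complex.I * b * dilationFourier ξ h b a
      = a * dilationFourier (deriv ξ) h b a + dilationFourier ξ (deriv h) b a := by
  have hd : ∀ t : ℝ, HasDerivAt (fun t : ℝ => ξ (a * t) * h t)
      (a * (deriv ξ (a * t) * h t) + ξ (a * t) * deriv h t) t := fun t => by
    have h1 : HasDerivAt (fun t : ℝ => ξ (a * t)) (a • deriv ξ (a * t)) t := by
      have := (hξ.1.differentiable one_ne_zero (a * t)).hasDerivAt.scomp t
        ((hasDerivAt_id t).const_mul a)
      simpa using! this
    convert! h1.mul (hh.1.differentiable one_ne_zero t).hasDerivAt using 1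
    rw [Complex.real_smul]
    ring
  have hi := integrable_comp_mul_mul hξ.1.continuous hh.1.continuous hh.2.1 a
  have hi1 := integrable_comp_mul_mul (hξ.1.continuous_deriv le_rfl) hh.1.continuous hh.2.1 a
  have hi2 := integrable_comp_mul_mul hξ.1.continuous (hh.1.continuous_deriv le_rfl)
    hh.2.1.deriv a
  have hderiv : deriv (fun t : ℝ => ξ (a * t) * h t)
      = fun t => a * (deriv ξ (a * t) * h t) + ξ (a * t) * deriv h t :=
    funext fun t => (hd t).deriv
  have key := congrFun (Real.fourier_deriv hi (fun t => (hd t).differentiableAt)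
    (by rw [hderiv]; exact (hi1.const_mul _).add hi2)) b
  rw [hderiv] at key
  simp only [dilationFourier]
  rw [← smul_eq_mul (2 * Real.pi * Complex.I * b : ℂ), ← key]
  simp only [Real.fourier_real_eq, Circle.smul_def, smul_eq_mul]
  rw [← integral_const_mul, ← integral_add]
  · congr 1 with t
    ring
  · have := ((Real.fourierIntegral_convergent_iff b).2 hi1).const_mul (a : ℂ)
    simpa [Circle.smul_def, mul_comm] using! this
  · have := (Real.fourierIntegral_convergent_iff b).2 hi2
    simpa [Circle.smul_def, mul_comm] using! this

lemma exists_dilationFourier_eq_zero {ξ h : ℝ → ℂ} (hξ : CcOne ξ) (hh : CcOne h) :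
    ∃ δ M : ℝ, 0 < δ ∧ 0 < M ∧ ∀ b a, a ∉ Icc δ M → dilationFourier ξ h b a = 0 := by
  obtain ⟨m₁, M₁, hm₁, hM₁, h₁⟩ := hξ.exists_support_subset_Icc
  obtain ⟨m₂, M₂, hm₂, hM₂, h₂⟩ := hh.exists_support_subset_Icc
  refine ⟨m₁ / M₂, M₁ / m₂, by positivity, by positivity, fun b a ha => ?_⟩
  have hz : (fun t : ℝ => ξ (a * t) * h t) = fun _ => 0 := by
    funext t
    by_contra hne
    obtain ⟨hx, hy⟩ := mul_ne_zero_iff.1 hne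
    obtain ⟨hx1, hx2⟩ := h₁ _ hx
    obtain ⟨hy1, hy2⟩ := h₂ _ hy
    have ht : 0 < t := hm₂.trans_le hy1
    have ha0 : 0 < a := pos_of_mul_pos_left (hm₁.trans_le hx1) ht.le
    refine ha ⟨?_, ?_⟩
    · rw [div_le_iff₀ hM₂]
      exact hx1.trans (by gcongr)
    · rw [le_div_iff₀ hm₂]
      exact le_trans (by gcongr) hx2
  rw [dilationFourier, hz, Real.fourier_real_eq]
  simp

lemma exists_norm_dilationFourier_mul_le {ξ h : ℝ → ℂ} (hξ : CcOne ξ) (hh : CcOne h) :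
    ∃ C δ M : ℝ, 0 ≤ C ∧ 0 < δ ∧ ∀ b a,
      ‖dilationFourier ξ h b a‖ * (1 + |b|) ≤ (Icc δ M).indicator (fun _ => C) a := by
  obtain ⟨δ, M, hδ, hM, hz⟩ := exists_dilationFourier_eq_zero hξ hh
  obtain ⟨C₀, hC₀, h₀⟩ := exists_norm_dilationFourier_le hξ.1.continuous hξ.2.1
    hh.1.continuous hh.2.1
  obtain ⟨C₁, hC₁, h₁⟩ := exists_norm_dilationFourier_le (hξ.1.continuous_deriv le_rfl)
    hξ.2.1.deriv hh.1.continuous hh.2.1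
  obtain ⟨C₂, hC₂, h₂⟩ := exists_norm_dilationFourier_le hξ.1.continuous hξ.2.1
    (hh.1.continuous_deriv le_rfl) hh.2.1.deriv
  refine ⟨C₀ + (M * C₁ + C₂), δ, M, by positivity, hδ, fun b a => ?_⟩
  by_cases ha : a ∈ Icc δ M
  · rw [indicator_of_mem ha, mul_add, mul_one]
    refine add_le_add (h₀ b a) ?_
    have hkey := congrArg norm (mul_dilationFourier hξ hh b a)
    simp only [norm_mul, Complex.norm_ofNat, Complex.norm_real, Complex.norm_I, mul_one,
      Real.norm_eq_abs, abs_of_pos Real.pi_pos] at hkey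
    have ha0 : 0 < a := hδ.trans_le ha.1
    have hle : ‖a * dilationFourier (deriv ξ) h b a + dilationFourier ξ (deriv h) b a‖
        ≤ M * C₁ + C₂ := by
      refine (norm_add_le _ _).trans (add_le_add ?_ (h₂ b a))
      rw [norm_mul, Complex.norm_real, Real.norm_eq_abs, abs_of_pos ha0]
      exact mul_le_mul ha.2 (h₁ b a) (norm_nonneg _) hM.le
    have hnn : 0 ≤ |b| * ‖dilationFourier ξ h b a‖ := by positivity
    have hpi := Real.pi_gt_three
    nlinarith
  · rw [indicator_of_notMem ha, hz b a ha]
    simp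

lemma stronglyMeasurable_dilationFourier {ξ h : ℝ → ℂ} (hξ : Continuous ξ) (hh : Continuous h)
    (ε : ℝ) : StronglyMeasurable fun p : ℝ × ℝ => dilationFourier ξ h (ε * p.1) p.2 := by
  simp only [dilationFourier, Real.fourier_real_eq_integral_exp_smul]
  refine StronglyMeasurable.integral_prod_right (f := fun (p : ℝ × ℝ) (t : ℝ) =>
    Complex.exp (↑(-2 * Real.pi * t * (ε * p.1)) * Complex.I) • (ξ (p.2 * t) * h t)) ?_
  refine Continuous.stronglyMeasurable ?_
  simp only [Function.uncurry_def]
  fun_prop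

lemma exists_norm_dilationFourier_mul_dilationFourier_le {ξ₁ h₁ ξ₂ h₂ : ℝ → ℂ}
    (hξ₁ : CcOne ξ₁) (hh₁ : CcOne h₁) (hξ₂ : CcOne ξ₂) (hh₂ : CcOne h₂) {ε₁ ε₂ : ℝ}
    (hε₁ : |ε₁| = 1) (hε₂ : |ε₂| = 1) :
    ∃ C δ M : ℝ, 0 ≤ C ∧ 0 < δ ∧ ∀ b a,
      ‖dilationFourier ξ₁ h₁ (ε₁ * b) a * dilationFourier ξ₂ h₂ (ε₂ * b) a‖
        ≤ (1 + b ^ 2)⁻¹ * (Icc δ M).indicator (fun _ => C) a := by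
  obtain ⟨C₁, δ, M, hC₁, hδ, hb₁⟩ := exists_norm_dilationFourier_mul_le hξ₁ hh₁
  obtain ⟨C₂, δ₂, M₂, hC₂, -, hb₂⟩ := exists_norm_dilationFourier_mul_le hξ₂ hh₂
  refine ⟨C₁ * C₂, δ, M, by positivity, hδ, fun b a => ?_⟩
  have e₁ := hb₁ (ε₁ * b) a
  have e₂ := (hb₂ (ε₂ * b) a).trans (indicator_le_self' (fun _ _ => hC₂) a)
  rw [abs_mul, hε₁, one_mul] at e₁
  rw [abs_mul, hε₂, one_mul] at e₂
  have hpos : 0 < 1 + b ^ 2 := by positivity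
  rw [inv_mul_eq_div, le_div_iff₀ hpos, norm_mul]
  set x := ‖dilationFourier ξ₁ h₁ (ε₁ * b) a‖
  set y := ‖dilationFourier ξ₂ h₂ (ε₂ * b) a‖
  calc x * y * (1 + b ^ 2) ≤ x * y * ((1 + |b|) * (1 + |b|)) := by
        gcongr
        nlinarith [sq_abs b, abs_nonneg b]
    _ = (x * (1 + |b|)) * (y * (1 + |b|)) := by ring
    _ ≤ (Icc δ M).indicator (fun _ => C₁) a * C₂ :=
        mul_le_mul e₁ e₂ (by positivity) (indicator_nonneg (fun _ _ => hC₁) a)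
    _ = (Icc δ M).indicator (fun _ => C₁ * C₂) a := by
        by_cases ha : a ∈ Icc δ M <;> simp [ha]

lemma integrable_dilationFourier_mul {ξ₁ h₁ ξ₂ h₂ : ℝ → ℂ}
    (hξ₁ : CcOne ξ₁) (hh₁ : CcOne h₁) (hξ₂ : CcOne ξ₂) (hh₂ : CcOne h₂) {ε₁ ε₂ : ℝ}
    (hε₁ : |ε₁| = 1) (hε₂ : |ε₂| = 1) (a : ℝ) :
    Integrable fun b =>
      dilationFourier ξ₁ h₁ (ε₁ * b) a * dilationFourier ξ₂ h₂ (ε₂ * b) a := by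
  obtain ⟨C, δ, M, -, -, hb⟩ :=
    exists_norm_dilationFourier_mul_dilationFourier_le hξ₁ hh₁ hξ₂ hh₂ hε₁ hε₂
  refine (integrable_inv_one_add_sq.mul_const ((Icc δ M).indicator (fun _ => C) a)).mono' ?_
    (Filter.Eventually.of_forall fun b => hb b a)
  have hm := (stronglyMeasurable_dilationFourier hξ₁.1.continuous hh₁.1.continuous ε₁).mul
    (stronglyMeasurable_dilationFourier hξ₂.1.continuous hh₂.1.continuous ε₂)
  exact (hm.comp_measurable (measurable_prodMk_right (y := a))).aestronglyMeasurable

lemma integrable_muG_iff {F : ℝ × ℝ → ℂ} :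
    Integrable F muG ↔ Integrable (fun p : ℝ × ℝ => (p.2 ^ 2)⁻¹ • F p)
      ((volume : Measure ℝ).prod ((volume : Measure ℝ).restrict (Ioi (0 : ℝ)))) := by
  rw [muG, integrable_withDensity_iff_integrable_smul' (by fun_prop)
    (Filter.Eventually.of_forall fun _ => ENNReal.ofReal_lt_top)]
  simp only [fun p : ℝ × ℝ => ENNReal.toReal_ofReal (inv_nonneg.2 (sq_nonneg p.2))]

lemma integral_muG (F : ℝ × ℝ → ℂ) :
    ∫ p, F p ∂muG = ∫ p : ℝ × ℝ, (p.2 ^ 2)⁻¹ • F p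
      ∂((volume : Measure ℝ).prod ((volume : Measure ℝ).restrict (Ioi (0 : ℝ)))) := by
  rw [muG, integral_withDensity_eq_integral_toReal_smul (by fun_prop)
    (Filter.Eventually.of_forall fun _ => ENNReal.ofReal_lt_top)]
  simp only [fun p : ℝ × ℝ => ENNReal.toReal_ofReal (inv_nonneg.2 (sq_nonneg p.2))]

lemma integrable_muG_dilationFourier_mul {ξ₁ h₁ ξ₂ h₂ : ℝ → ℂ}
    (hξ₁ : CcOne ξ₁) (hh₁ : CcOne h₁) (hξ₂ : CcOne ξ₂) (hh₂ : CcOne h₂) {ε₁ ε₂ : ℝ}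
    (hε₁ : |ε₁| = 1) (hε₂ : |ε₂| = 1) :
    Integrable (fun p : ℝ × ℝ => (p.2 : ℂ) *
      (dilationFourier ξ₁ h₁ (ε₁ * p.1) p.2 * dilationFourier ξ₂ h₂ (ε₂ * p.1) p.2)) muG := by
  obtain ⟨C, δ, M, hC, hδ, hb⟩ :=
    exists_norm_dilationFourier_mul_dilationFourier_le hξ₁ hh₁ hξ₂ hh₂ hε₁ hε₂
  have hind : Integrable ((Icc δ M).indicator fun _ => δ⁻¹ * C)
      ((volume : Measure ℝ).restrict (Ioi (0 : ℝ))) :=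
    ((integrable_indicator_iff measurableSet_Icc).2
      (integrableOn_const measure_Icc_lt_top.ne)).restrict
  rw [integrable_muG_iff]
  refine (integrable_inv_one_add_sq.mul_prod hind).mono' ?_ ?_
  · have hm := (stronglyMeasurable_dilationFourier hξ₁.1.continuous hh₁.1.continuous ε₁).mul
      (stronglyMeasurable_dilationFourier hξ₂.1.continuous hh₂.1.continuous ε₂)
    have h2 : StronglyMeasurable fun p : ℝ × ℝ => (p.2 : ℂ) :=
      Continuous.stronglyMeasurable (by fun_prop)
    have h3 : StronglyMeasurable fun p : ℝ × ℝ => (p.2 ^ 2)⁻¹ :=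
      Measurable.stronglyMeasurable (by fun_prop)
    exact (h3.smul (h2.mul hm)).aestronglyMeasurable
  · refine Filter.Eventually.of_forall fun p => ?_
    rw [norm_smul, norm_mul, Complex.norm_real]
    have hp := hb p.1 p.2
    by_cases ha : p.2 ∈ Icc δ M
    · rw [indicator_of_mem ha] at hp ⊢
      have ha0 : 0 < p.2 := hδ.trans_le ha.1
      have hinv : p.2⁻¹ ≤ δ⁻¹ := inv_anti₀ hδ ha.1
      rw [Real.norm_of_nonneg (by positivity), Real.norm_of_nonneg ha0.le, ← mul_assoc,
        show (p.2 ^ 2)⁻¹ * p.2 = p.2⁻¹ by field_simp]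
      calc _ ≤ δ⁻¹ * ((1 + p.1 ^ 2)⁻¹ * C) := by gcongr
        _ = _ := by ring
    · rw [indicator_of_notMem ha, mul_zero] at hp ⊢
      rw [le_antisymm hp (norm_nonneg _)]
      simp

lemma hasDerivAt_dilationFourier {ξ h : ℝ → ℂ} (hξ : CcOne ξ) (hh : CcOne h) (ε b a : ℝ) :
    HasDerivAt (fun b => dilationFourier ξ h (ε * b) a)
      (ε * (-2 * Real.pi * Complex.I) * dilationFourier ξ (fun t => h t * t) (ε * b) a) b := by
  have hi := integrable_comp_mul_mul hξ.1.continuous hh.1.continuous hh.2.1 a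
  have hi' := integrable_comp_mul_mul hξ.1.continuous hh.mul_ofReal.1.continuous
    hh.mul_ofReal.2.1 a
  have hd := Real.hasDerivAt_fourier hi
    (hi'.congr (Filter.Eventually.of_forall fun t => by
      simp only [Complex.real_smul]; ring)) (ε * b)
  convert! hd.scomp b ((hasDerivAt_id b).const_mul ε) using 1
  simp only [dilationFourier, Real.fourier_real_eq, Circle.smul_def, smul_eq_mul, mul_one,
    Complex.real_smul]
  rw [mul_assoc, ← integral_const_mul]
  congr 2 with t
  ring

/-- Antisymmetry of the bilinear form `D♭(f,g) = ∫_G (-(2πi)⁻¹ a ∂_b f) g dμ` on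
convenient coefficient functions of `π₊` and `π₋` (used in the proof of Theorem 4.9
of Choi–Ghandehari):  `D♭(f,g) = -D♭(g,f)` when `f = ξ₁ *_s η₁` and `g = ξ₂ *_{s'} η₂`,
for any choices of signs `s, s'`. -/
theorem pairing_deriv_antisymmetric (ξ₁ η₁ ξ₂ η₂ : ℝ → ℂ)
    (hξ₁ : CcTwo ξ₁) (hη₁ : CcTwo η₁) (hξ₂ : CcTwo ξ₂) (hη₂ : CcTwo η₂)
    (s s' : Bool) :
    Integrable (fun p : ℝ × ℝ =>
      (-(2 * (Real.pi : ℂ) * Complex.I)⁻¹ * (p.2 : ℂ)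
          * deriv (fun b : ℝ => coeffS s ξ₁ η₁ b p.2) p.1)
        * coeffS s' ξ₂ η₂ p.1 p.2) muG ∧
    Integrable (fun p : ℝ × ℝ =>
      coeffS s ξ₁ η₁ p.1 p.2
        * (-(2 * (Real.pi : ℂ) * Complex.I)⁻¹ * (p.2 : ℂ)
          * deriv (fun b : ℝ => coeffS s' ξ₂ η₂ b p.2) p.1)) muG ∧
    ∫ p, (-(2 * (Real.pi : ℂ) * Complex.I)⁻¹ * (p.2 : ℂ)
          * deriv (fun b : ℝ => coeffS s ξ₁ η₁ b p.2) p.1)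
        * coeffS s' ξ₂ η₂ p.1 p.2 ∂muG
      = -∫ p, coeffS s ξ₁ η₁ p.1 p.2
          * (-(2 * (Real.pi : ℂ) * Complex.I)⁻¹ * (p.2 : ℂ)
            * deriv (fun b : ℝ => coeffS s' ξ₂ η₂ b p.2) p.1) ∂muG := by
  have hh₁ := hη₁.conj_mul_inv
  have hh₂ := hη₂.conj_mul_inv
  have hε := abs_fourierSign s
  have hε' := abs_fourierSign s'
  simp only [coeffS_eq_dilationFourier _ _ hη₁, coeffS_eq_dilationFourier _ _ hη₂,
    (hasDerivAt_dilationFourier hξ₁.ccOne hh₁ _ _ _).deriv,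
    (hasDerivAt_dilationFourier hξ₂.ccOne hh₂ _ _ _).deriv]
  set h₁ : ℝ → ℂ := fun t => starRingEnd ℂ (η₁ t) * (t : ℂ)⁻¹
  set h₂ : ℝ → ℂ := fun t => starRingEnd ℂ (η₂ t) * (t : ℂ)⁻¹
  set ε := fourierSign s
  set ε' := fourierSign s'
  set c : ℂ := -(2 * (Real.pi : ℂ) * Complex.I)⁻¹
  set d : ℂ := -2 * Real.pi * Complex.I
  have hint₁ : Integrable (fun p : ℝ × ℝ =>
      (c * (p.2 : ℂ) * (ε * d * dilationFourier ξ₁ (fun t => h₁ t * t) (ε * p.1) p.2))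
        * dilationFourier ξ₂ h₂ (ε' * p.1) p.2) muG := by
    refine ((integrable_muG_dilationFourier_mul hξ₁.ccOne hh₁.mul_ofReal hξ₂.ccOne hh₂ hε
      hε').const_mul (c * ε * d)).congr (Filter.Eventually.of_forall fun p => ?_)
    simp only
    ring
  have hint₂ : Integrable (fun p : ℝ × ℝ => dilationFourier ξ₁ h₁ (ε * p.1) p.2
        * (c * (p.2 : ℂ) * (ε' * d * dilationFourier ξ₂ (fun t => h₂ t * t) (ε' * p.1) p.2)))
      muG := by
    refine ((integrable_muG_dilationFourier_mul hξ₁.ccOne hh₁ hξ₂.ccOne hh₂.mul_ofReal hε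
      hε').const_mul (c * ε' * d)).congr (Filter.Eventually.of_forall fun p => ?_)
    simp only
    ring
  refine ⟨hint₁, hint₂, ?_⟩
  rw [integral_muG, integral_muG, integral_prod_symm _ (integrable_muG_iff.1 hint₁),
    integral_prod_symm _ (integrable_muG_iff.1 hint₂), ← integral_neg]
  congr 1 with a
  have hparts := integral_mul_deriv_eq_deriv_mul_of_integrable
    (fun b _ => hasDerivAt_dilationFourier hξ₁.ccOne hh₁ ε b a)
    (fun b _ => hasDerivAt_dilationFourier hξ₂.ccOne hh₂ ε' b a)
    (((integrable_dilationFourier_mul hξ₁.ccOne hh₁ hξ₂.ccOne hh₂.mul_ofReal hε hε'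
      a).const_mul (ε' * d)).congr (Filter.Eventually.of_forall fun b => by
        simp only [Pi.mul_apply]; ring))
    (((integrable_dilationFourier_mul hξ₁.ccOne hh₁.mul_ofReal hξ₂.ccOne hh₂ hε hε'
      a).const_mul (ε * d)).congr (Filter.Eventually.of_forall fun b => by
        simp only [Pi.mul_apply]; ring))
    (integrable_dilationFourier_mul hξ₁.ccOne hh₁ hξ₂.ccOne hh₂ hε hε' a)
  simp only [integral_smul, ← smul_neg]
  congr 1
  rw [eq_comm, neg_eq_iff_eq_neg] at hparts
  calc _ = c * a * ∫ b, ε * d * dilationFourier ξ₁ (fun t => h₁ t * t) (ε * b) a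
          * dilationFourier ξ₂ h₂ (ε' * b) a := by
        rw [← integral_const_mul]
        congr 1 with b
        ring
    _ = _ := by
        rw [hparts, mul_neg, ← integral_const_mul]
        congr 2 with b
        ring
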